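/- arXiv:2211.12936 — 4 statements merged into one kernel-verified Lean document; each statement's English description precedes it below -/
import Mathlib

section
/- Assume the Continuum Hypothesis. Let ℒ be a finite relational signature, 𝒟 a nonprincipal ultrafilter over ω, (M_t)_{t∈ω} a 𝒟-trending sequence of finite ℒ-structures, and M* = ∏_{t∈ω} M_t/𝒟. Let 𝒜 ∈ age(M*) and suppose 𝒜 has finite small Ramsey degree in age(M*). Then 𝒜 has finite internal big Ramsey degree in M*, and T_int(𝒜, M*) ≤ d(𝒜, age(M*)). -/
open FirstOrder Language CategoryTheory Filter

universe u v w x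

namespace BRD

variable (L : FirstOrder.Language.{u, v})

/-- The set of copies of `A` in `N`: substructures of `N` isomorphic to `A`. -/
def Copy (A : Type*) [L.Structure A] (N : Type*) [L.Structure N] :=
  {S : L.Substructure N // Nonempty (A ≃[L] S)}

/-- A coloring `c` takes at most `ℓ` values on the copies of `A` contained in `N'`. -/
def ChromaticLE {A : Type*} [L.Structure A] {N : Type*} [L.Structure N] {k : ℕ}
    (c : Copy L A N → Fin k) (N' : L.Substructure N) (ℓ : ℕ) : Prop :=
  ∃ vals : Finset (Fin k), vals.card ≤ ℓ ∧ ∀ S : Copy L A N, S.1 ≤ N' → c S ∈ vals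

/-- `ℓ` witnesses the small Ramsey property for `A` in the class `𝒦` : for every number of
colors `k` and every `B ∈ 𝒦` there is `C ∈ 𝒦` such that every `k`-coloring of the copies of
`A` in `C` takes at most `ℓ` values on the copies of `A` in some copy of `B` in `C`. -/
def SmallRamseyWitness (𝒦 : Set (Bundled.{w} L.Structure)) (A : Bundled.{w} L.Structure)
    (ℓ : ℕ) : Prop :=
  ∀ k : ℕ, ∀ B ∈ 𝒦, ∃ C ∈ 𝒦, ∀ c : Copy L A C → Fin k,
    ∃ B' : L.Substructure C, Nonempty (B ≃[L] B') ∧ ChromaticLE L c B' ℓ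

variable {ι : Type x} (𝒟 : Ultrafilter ι) (M : ι → Type w) [∀ t, L.Structure (M t)]

/-- The projection `𝒜[t]` of a substructure `𝒜` of the ultraproduct to coordinate `t`,
using a fixed choice of representatives: the substructure of `M t` with underlying set
`{a[t] : a ∈ 𝒜}`. -/
noncomputable def coordSub (S : L.Substructure ((𝒟 : Filter ι).Product M)) (t : ι) :
    L.Substructure (M t) :=
  Substructure.closure L
    ((fun a : (𝒟 : Filter ι).Product M =>
        (Quotient.out (s := (𝒟 : Filter ι).productSetoid M) a) t) '' S)

/-- A `k`-coloring `c` of the copies of `A` in the ultraproduct is internal if it is induced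
by coordinatewise colorings `ct` on a set `Z` of the ultrafilter: `c 𝒜' = j` iff the set of
`t ∈ Z` such that `𝒜'[t] ≅ A` and `ct t 𝒜'[t] = j` belongs to the ultrafilter. -/
def IsInternalColoring {k : ℕ} (A : Type*) [L.Structure A]
    (c : Copy L A ((𝒟 : Filter ι).Product M) → Fin k) : Prop :=
  ∃ Z ∈ 𝒟, ∃ ct : ∀ t : ι, Copy L A (M t) → Fin k,
    ∀ (A' : Copy L A ((𝒟 : Filter ι).Product M)) (j : Fin k),
      c A' = j ↔
        {t | t ∈ Z ∧ ∃ e : A ≃[L] (coordSub L 𝒟 M A'.1 t),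
          ct t ⟨coordSub L 𝒟 M A'.1 t, ⟨e⟩⟩ = j} ∈ 𝒟

/-- A sequence of finite structures is `𝒟`-trending: cardinalities are nondecreasing and tend
to infinity, and each `M i` embeds into `𝒟`-many of the `M t`. -/
def DTrending (𝒟 : Ultrafilter ℕ) (M : ℕ → Type w) [∀ t, L.Structure (M t)] : Prop :=
  (∀ s t : ℕ, s < t → Nat.card (M s) ≤ Nat.card (M t)) ∧
  Filter.Tendsto (fun t => Nat.card (M t)) Filter.atTop Filter.atTop ∧
  ∀ i : ℕ, {t | Nonempty (M i ↪[L] M t)} ∈ 𝒟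

/-- `ℓ` witnesses the internal big Ramsey property for `A` in the ultraproduct `M*`: every
internal coloring of the copies of `A` in `M*` takes at most `ℓ` values on the copies of `A`
contained in some copy of `M*` within `M*`. -/
def InternalBigRamseyWitness (𝒟 : Ultrafilter ℕ) (M : ℕ → Type w) [∀ t, L.Structure (M t)]
    (A : Type*) [L.Structure A] (ℓ : ℕ) : Prop :=
  ∀ k : ℕ, ∀ c : Copy L A ((𝒟 : Filter ℕ).Product M) → Fin k,
    IsInternalColoring L 𝒟 M A c →
      ∃ N' : L.Substructure ((𝒟 : Filter ℕ).Product M),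
        Nonempty (((𝒟 : Filter ℕ).Product M) ≃[L] N') ∧ ChromaticLE L c N' ℓ

/-- Diagonal choice: a sequence of sets that are large for a filter finer than `atTop`
admits an index function tending to infinity that selects a set containing the current point. -/
theorem exists_tendsto_atTop_of_eventually {l : Filter ℕ} (hl : l ≤ atTop) (P : ℕ → ℕ → Prop)
    (hP : ∀ m, ∀ᶠ t in l, P m t) :
    ∃ n : ℕ → ℕ, Tendsto n l atTop ∧ ∀ᶠ t in l, P (n t) t := by
  classical
  refine ⟨fun t => Nat.findGreatest (fun m => P m t) t, tendsto_atTop.2 fun K => ?_, ?_⟩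
  · filter_upwards [hP K, hl (eventually_ge_atTop K)] with t ht hKt
    exact Nat.le_findGreatest hKt ht
  · filter_upwards [hP 0] with t ht
    exact Nat.findGreatest_spec (P := fun m => P m t) (Nat.zero_le t) ht

/-- The class of a function in a filter product. -/
def productMk {ι : Type*} (l : Filter ι) {N : ι → Type*} (x : ∀ t, N t) : l.Product N :=
  Quotient.mk (l.productSetoid N) x

/-- A representative of an element of a filter product. -/
noncomputable def productOut {ι : Type*} {l : Filter ι} {N : ι → Type*} (a : l.Product N) :
    ∀ t, N t :=
  Quotient.out (s := l.productSetoid N) a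

theorem productMk_productOut {ι : Type*} {l : Filter ι} {N : ι → Type*} (a : l.Product N) :
    productMk l (productOut a) = a :=
  Quotient.out_eq (s := l.productSetoid N) a

theorem productMk_eq_iff {ι : Type*} {l : Filter ι} {N : ι → Type*} {x y : ∀ t, N t} :
    productMk l x = productMk l y ↔ ∀ᶠ t in l, x t = y t :=
  Quotient.eq (r := l.productSetoid N)

theorem productOut_productMk {ι : Type*} {l : Filter ι} {N : ι → Type*} (x : ∀ t, N t) :
    ∀ᶠ t in l, productOut (productMk l x) t = x t :=
  productMk_eq_iff.1 (productMk_productOut _)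

theorem relMap_productMk {ι : Type*} {L : FirstOrder.Language.{u, v}} {𝒟 : Ultrafilter ι}
    {N : ι → Type*} [∀ t, L.Structure (N t)] {n : ℕ}
    (r : L.Relations n) (x : Fin n → ∀ t, N t) :
    Structure.RelMap r (fun i => productMk (𝒟 : Filter ι) (x i)) ↔
      ∀ᶠ t in 𝒟, Structure.RelMap r fun i => x i t :=
  relMap_quotient_mk' ..

theorem relMap_iff_productOut {ι : Type*} {L : FirstOrder.Language.{u, v}} {𝒟 : Ultrafilter ι}
    {N : ι → Type*} [∀ t, L.Structure (N t)] {n : ℕ}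
    (r : L.Relations n) (x : Fin n → (𝒟 : Filter ι).Product N) :
    Structure.RelMap r x ↔ ∀ᶠ t in 𝒟, Structure.RelMap r fun i => productOut (x i) t := by
  rw [← relMap_productMk]
  simp only [productMk_productOut]

theorem realize_iff_productOut {ι : Type*} {L : FirstOrder.Language.{u, v}}
    {𝒟 : Ultrafilter ι} {N : ι → Type*} [∀ t, L.Structure (N t)] [∀ t, Nonempty (N t)]
    {β : Type*} (φ : L.Formula β) (x : β → (𝒟 : Filter ι).Product N) :
    φ.Realize x ↔ ∀ᶠ t in 𝒟, φ.Realize fun i => productOut (x i) t := by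
  have h : x = fun i => productMk (𝒟 : Filter ι) (productOut (x i)) := by
    simp only [productMk_productOut]
  conv_lhs => rw [h]
  exact Ultraproduct.realize_formula_cast φ _

section Saturation

variable {L : FirstOrder.Language.{u, v}} {𝒟 : Ultrafilter ℕ} {N : ℕ → Type*}
  [∀ t, L.Structure (N t)] [∀ t, Nonempty (N t)]

/-- Countable saturation of ultraproducts along an ultrafilter finer than `atTop`. -/
theorem exists_realize_of_forall_finite (hD : (𝒟 : Filter ℕ) ≤ atTop) {α : Type*}
    (φ : ℕ → L.Formula (α ⊕ Unit)) (v : α → (𝒟 : Filter ℕ).Product N)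
    (h : ∀ m, ∃ y, ∀ k ≤ m, (φ k).Realize (Sum.elim v fun _ => y)) :
    ∃ y, ∀ k, (φ k).Realize (Sum.elim v fun _ => y) := by
  have los (ψ : L.Formula (α ⊕ Unit)) (x : (𝒟 : Filter ℕ).Product N) :
      ψ.Realize (Sum.elim v fun _ => x) ↔
        ∀ᶠ t in 𝒟, ψ.Realize (Sum.elim (fun a => productOut (v a) t) fun _ => productOut x t) := by
    rw [realize_iff_productOut]
    refine eventually_congr (Eventually.of_forall fun t => ?_)
    have : (fun i : α ⊕ Unit => productOut (Sum.elim v (fun _ => x) i) t) =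
        Sum.elim (fun a => productOut (v a) t) fun _ => productOut x t := by
      funext i
      rcases i with a | a <;> rfl
    rw [this]
  obtain ⟨n, hn, hE⟩ := exists_tendsto_atTop_of_eventually hD
    (fun m t => ∃ y : N t, ∀ k ≤ m,
      (φ k).Realize (Sum.elim (fun a => productOut (v a) t) fun _ => y)) (by
    intro m
    obtain ⟨y, hy⟩ := h m
    have hy' : ∀ᶠ t in 𝒟, ∀ k ∈ Set.Iic m,
        (φ k).Realize (Sum.elim (fun a => productOut (v a) t) fun _ => productOut y t) :=
      (eventually_all_finite (Set.finite_Iic m)).2 fun k hk => (los _ _).1 (hy k hk)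
    filter_upwards [hy'] with t ht
    exact ⟨_, ht⟩)
  let x (t : ℕ) : N t := Classical.epsilon fun y : N t => ∀ k ≤ n t,
      (φ k).Realize (Sum.elim (fun a => productOut (v a) t) fun _ => y)
  refine ⟨productMk _ x, fun k => (los _ _).2 ?_⟩
  filter_upwards [hE, hn.eventually_ge_atTop k, productOut_productMk (l := (𝒟 : Filter ℕ)) x]
    with t ht hk hx
  rw [hx]
  exact Classical.epsilon_spec ht k hk

end Saturation

section Universality

variable {L : FirstOrder.Language.{u, v}} {I J : Type*}

/-- The type of `q` over the index set `s` is the limit along `U` of the types of `e j`. -/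
def IsLimitType (L : FirstOrder.Language.{u, v}) {I J P : Type*} [L.Structure P]
    (U : Ultrafilter J) (e : J → I → P) (s : Set I) (q : s → P) : Prop :=
  ∀ φ : L.Formula s, φ.Realize q ↔ ∀ᶠ j in U, φ.Realize fun a => e j a

/-- Limit types on initial segments determine limit types of arbitrary tuples. -/
theorem realize_iff_of_isLimitType_Iic {P : Type*} [L.Structure P] [LinearOrder I]
    {U : Ultrafilter J} {e : J → I → P} {q : I → P} {β : Type*} (w : β → I)
    (h : ∀ b, IsLimitType L U e (Set.Iic (w b)) fun a => q a) (φ : L.Formula β) :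
    φ.Realize (fun b => q (w b)) ↔ ∀ᶠ j in U, φ.Realize fun b => e j (w b) := by
  classical
  rcases (φ.freeVarFinset).eq_empty_or_nonempty with h0 | hne
  · have key (v v' : β → P) : φ.Realize v → φ.Realize v' := fun hv => by
      have hf : ∀ a : φ.freeVarFinset, False := fun a => by simpa [h0] using a.2
      have := (BoundedFormula.realize_restrictFreeVar (φ := φ) (f := id)
        (v := fun a => v a) (xs := default) v (fun _ => rfl)).2 hv
      refine (BoundedFormula.realize_restrictFreeVar (φ := φ) (f := id)
        (v := fun a => v a) (xs := default) v' (fun a => (hf a).elim)).1 this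
    constructor
    · intro hq
      exact Eventually.of_forall fun j => key _ _ hq
    · intro hU
      obtain ⟨j, hj⟩ := hU.exists
      exact key _ _ hj
  · obtain ⟨b, hb, hmax⟩ := Finset.exists_max_image φ.freeVarFinset w hne
    let f : φ.freeVarFinset → Set.Iic (w b) := fun a => ⟨w a, hmax a a.2⟩
    have key (v : I → P) : Formula.Realize (φ.restrictFreeVar f : L.Formula (Set.Iic (w b)))
        (fun a => v a) ↔ φ.Realize fun b => v (w b) :=
      BoundedFormula.realize_restrictFreeVar _ fun a => rfl
    rw [← key]
    simp only [← key]
    exact h b _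

variable {𝒟 : Ultrafilter ℕ} {N : ℕ → Type*}
  [∀ t, L.Structure (N t)] [∀ t, Nonempty (N t)]

/-- One-point extension of limit types in a countably saturated ultraproduct. -/
theorem exists_isLimitType_Iic (hD : (𝒟 : Filter ℕ) ≤ atTop) [Countable L.Symbols]
    [LinearOrder I] {U : Ultrafilter J} {e : J → I → (𝒟 : Filter ℕ).Product N} (i : I)
    [Countable (Set.Iic i)] (q : Set.Iio i → (𝒟 : Filter ℕ).Product N)
    (h : IsLimitType L U e (Set.Iio i) q) :
    ∃ x, IsLimitType L U e (Set.Iic i)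
      fun a => if ha : a.1 < i then q ⟨a.1, ha⟩ else x := by
  classical
  let g : Set.Iic i → Set.Iio i ⊕ Unit := fun a =>
    if ha : a.1 < i then Sum.inl ⟨a.1, ha⟩ else Sum.inr ()
  have hg (x) (a : Set.Iic i) : Sum.elim q (fun _ => x) (g a) =
      if ha : a.1 < i then q ⟨a.1, ha⟩ else x := by
    by_cases ha : a.1 < i <;> simp [g, ha]
  have hg' (j : J) (a : Set.Iic i) :
      Sum.elim (fun b : Set.Iio i => e j b) (fun _ => e j i) (g a) = e j a := by
    by_cases ha : a.1 < i
    · simp [g, ha]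
    · simp [g, le_antisymm a.2 (not_lt.1 ha)]
  let T := {φ : L.Formula (Set.Iic i) // ∀ᶠ j in U, φ.Realize fun a => e j a}
  have : Nonempty T := ⟨⟨⊤, by simp⟩⟩
  obtain ⟨F, hF⟩ := exists_surjective_nat T
  obtain ⟨x, hx⟩ := exists_realize_of_forall_finite hD
    (fun m => (F m).1.relabel g) q (by
    intro m
    let ψ : L.Formula (Set.Iio i) :=
      Formula.iExs Unit (Formula.iInf fun k : Fin (m + 1) => (F k).1.relabel g)
    have hψ : ψ.Realize q := by
      rw [h ψ]
      have : ∀ᶠ j in U, ∀ k : Fin (m + 1), (F k).1.Realize fun a => e j a :=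
        eventually_all.2 fun k => (F k).2
      filter_upwards [this] with j hj
      simp only [ψ, Formula.realize_iExs, Formula.realize_iInf,
        Formula.realize_relabel]
      refine ⟨fun _ => e j i, fun k => ?_⟩
      convert hj k using 1
      funext a
      exact hg' j a
    simp only [ψ, Formula.realize_iExs, Formula.realize_iInf] at hψ
    obtain ⟨y, hy⟩ := hψ
    exact ⟨y (), fun k hk => hy ⟨k, Nat.lt_succ_of_le hk⟩⟩)
  have hx' (φ : L.Formula (Set.Iic i)) (hφ : ∀ᶠ j in U, φ.Realize fun a => e j a) :
      φ.Realize fun a => if ha : a.1 < i then q ⟨a.1, ha⟩ else x := by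
    obtain ⟨m, hm⟩ := hF ⟨φ, hφ⟩
    have := hx m
    rw [hm, Formula.realize_relabel] at this
    convert this using 1
    funext a
    exact (hg x a).symm
  refine ⟨x, fun φ => ⟨fun hφ => ?_, hx' φ⟩⟩
  by_contra hcon
  rw [← Ultrafilter.eventually_not] at hcon
  exact hx' (∼φ) (by simpa [Formula.realize_not] using hcon) hφ

/-- Limit types are realized along well-orders with countable initial segments. -/
theorem exists_realize_iff_eventually (hD : (𝒟 : Filter ℕ) ≤ atTop) [Countable L.Symbols]
    [LinearOrder I] [WellFoundedLT I] (hI : ∀ i : I, (Set.Iic i).Countable)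
    (U : Ultrafilter J) (e : J → I → (𝒟 : Filter ℕ).Product N) :
    ∃ q : I → (𝒟 : Filter ℕ).Product N, ∀ {β : Type*} (w : β → I) (φ : L.Formula β),
      φ.Realize (fun b => q (w b)) ↔ ∀ᶠ j in U, φ.Realize fun b => e j (w b) := by
  classical
  let ext (i : I) (p : ∀ j, j < i → (𝒟 : Filter ℕ).Product N) (x : (𝒟 : Filter ℕ).Product N) :
      Set.Iic i → (𝒟 : Filter ℕ).Product N :=
    fun a => if ha : a.1 < i then p a.1 ha else x
  let step (i : I) (p : ∀ j, j < i → (𝒟 : Filter ℕ).Product N) : (𝒟 : Filter ℕ).Product N :=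
    Classical.epsilon fun x => IsLimitType L U e (Set.Iic i) (ext i p x)
  let q : I → (𝒟 : Filter ℕ).Product N := wellFounded_lt.fix step
  have hq (i : I) : q i = step i fun j _ => q j := wellFounded_lt.fix_eq step i
  have main (i : I) : IsLimitType L U e (Set.Iic i) fun a => q a := by
    induction i using WellFoundedLT.induction with
    | ind i ih =>
      have := (hI i).to_subtype
      have hex := exists_isLimitType_Iic hD i (fun a => q a.1)
        (fun φ => realize_iff_of_isLimitType_Iic (fun a : Set.Iio i => a.1)
          (fun b => ih b.1 b.2) φ)
      have hs : IsLimitType L U e (Set.Iic i)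
          (ext i (fun j _ => q j) (step i fun j _ => q j)) :=
        Classical.epsilon_spec (p := fun x => IsLimitType L U e (Set.Iic i)
          (ext i (fun j _ => q j) x)) hex
      convert hs using 1
      funext a
      by_cases ha : a.1 < i
      · simp [ext, ha]
      · simp [ext, ← hq, le_antisymm a.2 (not_lt.1 ha)]
  exact ⟨q, fun w φ => realize_iff_of_isLimitType_Iic w (fun b => main _) φ⟩

end Universality

/-- A structure of size at most `ℵ₁` embeds into an ultraproduct along an ultrafilter finer than
`atTop` as soon as its finite parts do. -/
theorem nonempty_embedding_of_finite_parts {L : FirstOrder.Language.{u, v}} [L.IsRelational]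
    [Countable L.Symbols] {𝒟 : Ultrafilter ℕ} (hD : (𝒟 : Filter ℕ) ≤ atTop)
    {N : ℕ → Type*} [∀ t, L.Structure (N t)] [∀ t, Nonempty (N t)]
    {P : Type w} [L.Structure P] (hP : Cardinal.mk P ≤ Cardinal.aleph 1)
    (hfin : ∀ F : Finset P, ∃ e : P → (𝒟 : Filter ℕ).Product N, Set.InjOn e F ∧
      ∀ (n : ℕ) (r : L.Relations n) (x : Fin n → P), (∀ i, x i ∈ F) →
        (Structure.RelMap r (e ∘ x) ↔ Structure.RelMap r x)) :
    Nonempty (P ↪[L] (𝒟 : Filter ℕ).Product N) := by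
  classical
  choose e he_inj he_rel using hfin
  let I : Type w := (Cardinal.aleph.{w} 1).ord.ToType
  have hI (i : I) : (Set.Iic i).Countable := by
    have h1 : Cardinal.mk (Set.Iio i) < Cardinal.aleph 1 := by
      simpa [I] using Cardinal.mk_Iio_lt i (by simp [I])
    have h2 : (Set.Iio i).Countable := by
      rw [← Cardinal.le_aleph0_iff_set_countable, ← Order.lt_succ_iff, ← Cardinal.aleph_zero,
        Cardinal.succ_aleph, zero_add]
      exact h1
    rw [← Set.Iio_insert]
    exact h2.insert i
  obtain ⟨ι⟩ : Nonempty (P ↪ I) := by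
    rw [← Cardinal.le_def]
    simpa [I] using hP
  let U : Ultrafilter (Finset P) := Ultrafilter.of atTop
  have hU (F : Finset P) : ∀ᶠ G in U, F ⊆ G :=
    Ultrafilter.of_le (atTop : Filter (Finset P)) (eventually_ge_atTop F)
  obtain ⟨q, hq⟩ := exists_realize_iff_eventually (L := L) hD hI U
    fun F => Function.extend ι (e F) fun _ => Classical.arbitrary _
  have hq' {n : ℕ} (x : Fin n → P) (φ : L.Formula (Fin n)) :
      φ.Realize (fun b => q (ι (x b))) ↔ ∀ᶠ F in U, φ.Realize fun b => e F (x b) := by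
    rw [hq (fun b => ι (x b)) φ]
    simp only [ι.injective.extend_apply]
  refine ⟨{ toFun := fun p => q (ι p), inj' := ?_, map_fun' := fun f => isEmptyElim f,
            map_rel' := ?_ }⟩
  · intro a b hab
    have h := (hq' ![a, b] ((Term.var 0).equal (Term.var 1))).1
      (by simpa [Formula.realize_equal] using hab)
    obtain ⟨F, hF, hF'⟩ := (h.and (hU {a, b})).exists
    refine he_inj F (hF' (by simp)) (hF' (by simp)) ?_
    simpa [Formula.realize_equal] using hF
  · intro n r x
    have h := hq' x (r.formula Term.var)
    simp only [Formula.realize_rel, Term.realize_var] at h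
    refine h.trans ?_
    have h' : ∀ᶠ F in U, (Structure.RelMap r (fun b => e F (x b)) ↔ Structure.RelMap r x) := by
      filter_upwards [hU (Finset.univ.image x)] with F hF
      exact he_rel F n r x fun i => hF (by simp)
    rw [eventually_congr h', eventually_const]

/-- Coordinatewise maps that eventually preserve and reflect everything give an embedding into
the ultraproduct. -/
theorem exists_embedding_product {ι : Type*} {L : FirstOrder.Language.{u, v}} [L.IsRelational]
    {𝒟 : Ultrafilter ι} {N : ι → Type*} [∀ t, L.Structure (N t)] {C : Type*} [L.Structure C]
    (f : C → ∀ t, N t) (hinj : ∀ x y, (∀ᶠ t in 𝒟, f x t = f y t) → x = y)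
    (hrel : ∀ (n : ℕ) (r : L.Relations n) (x : Fin n → C),
      (∀ᶠ t in 𝒟, Structure.RelMap r fun i => f (x i) t) ↔ Structure.RelMap r x) :
    ∃ F : C ↪[L] (𝒟 : Filter ι).Product N, ∀ c, F c = productMk _ (f c) :=
  ⟨{ toFun := fun c => productMk _ (f c)
     inj' := fun x y h => hinj x y (productMk_eq_iff.1 h)
     map_fun' := fun f => isEmptyElim f
     map_rel' := fun {n} r x => (relMap_productMk r fun i => f (x i)).trans (hrel n r x) },
    fun _ => rfl⟩

/-- A structure embeds into an ultraproduct if it eventually embeds into the factors. -/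
theorem nonempty_embedding_product_of_eventually {ι : Type*} {L : FirstOrder.Language.{u, v}}
    [L.IsRelational] {𝒟 : Ultrafilter ι} {N : ι → Type*} [∀ t, L.Structure (N t)]
    [∀ t, Nonempty (N t)] {C : Type*} [L.Structure C]
    (h : ∀ᶠ t in 𝒟, Nonempty (C ↪[L] N t)) :
    Nonempty (C ↪[L] (𝒟 : Filter ι).Product N) := by
  classical
  have hex (t : ι) : ∃ g : C → N t, Nonempty (C ↪[L] N t) → ∃ e : C ↪[L] N t, ⇑e = g := by
    by_cases ht : Nonempty (C ↪[L] N t)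
    · exact ⟨ht.some, fun _ => ⟨ht.some, rfl⟩⟩
    · exact ⟨fun _ => Classical.arbitrary _, fun h => (ht h).elim⟩
  choose g hg using hex
  obtain ⟨F, -⟩ := exists_embedding_product (L := L) (𝒟 := 𝒟) (fun (c : C) t => g t c)
    (by
      intro x y hxy
      obtain ⟨t, ht, ht'⟩ := (h.and hxy).exists
      obtain ⟨e, he⟩ := hg t ht
      exact e.injective (by rw [he]; exact ht'))
    (by
      intro n r x
      have : ∀ᶠ t in 𝒟, (Structure.RelMap r (fun i => g t (x i)) ↔ Structure.RelMap r x) := by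
        filter_upwards [h] with t ht
        obtain ⟨e, he⟩ := hg t ht
        rw [← he]
        exact e.map_rel r x
      rw [eventually_congr this, eventually_const])
  exact ⟨F⟩

/-- A finite structure embedded in an ultraproduct eventually embeds into the factors. -/
theorem eventually_nonempty_embedding {ι : Type*} {L : FirstOrder.Language.{u, v}}
    [L.IsRelational] [Finite (Σ n, L.Relations n)] {𝒟 : Ultrafilter ι} {N : ι → Type*}
    [∀ t, L.Structure (N t)] {C : Type*} [L.Structure C] [Finite C]
    (F : C ↪[L] (𝒟 : Filter ι).Product N) : ∀ᶠ t in 𝒟, Nonempty (C ↪[L] N t) := by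
  have h1 : ∀ᶠ t in 𝒟, ∀ x y : C, productOut (F x) t = productOut (F y) t → x = y := by
    refine eventually_all.2 fun x => eventually_all.2 fun y => ?_
    by_cases hxy : x = y
    · exact Eventually.of_forall fun _ _ => hxy
    · have : ¬ ∀ᶠ t in 𝒟, productOut (F x) t = productOut (F y) t := fun h =>
        hxy (F.injective (by
          rw [← productMk_productOut (F x), ← productMk_productOut (F y)]
          exact productMk_eq_iff.2 h))
      filter_upwards [Ultrafilter.eventually_not.2 this] with t ht h
      exact (ht h).elim
  have h2 : ∀ᶠ t in 𝒟, ∀ R : Σ n, L.Relations n, ∀ x : Fin R.1 → C,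
      (Structure.RelMap R.2 (fun i => productOut (F (x i)) t) ↔ Structure.RelMap R.2 x) := by
    refine eventually_all.2 fun R => eventually_all.2 fun x => ?_
    have h := (relMap_iff_productOut R.2 (F ∘ x)).symm.trans (F.map_rel R.2 x)
    by_cases hx : Structure.RelMap R.2 x
    · filter_upwards [h.2 hx] with t ht
      exact iff_of_true ht hx
    · filter_upwards [Ultrafilter.eventually_not.2 (mt h.1 hx)] with t ht
      exact iff_of_false ht hx
  filter_upwards [h1, h2] with t h1 h2
  exact ⟨{ toFun := fun c => productOut (F c) t, inj' := fun x y => h1 x y,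
           map_fun' := fun f => isEmptyElim f, map_rel' := fun {n} r x => h2 ⟨n, r⟩ x }⟩

/-- A countable ultraproduct of finite structures has at most continuum many elements. -/
theorem mk_product_le_continuum (l : Filter ℕ) (N : ℕ → Type w) [∀ t, Finite (N t)] :
    Cardinal.mk (l.Product N) ≤ Cardinal.continuum := by
  have h : Function.Injective fun a : l.Product N =>
      fun t => (Finite.equivFin (N t) (productOut a t) : ℕ) := by
    intro a b hab
    rw [← productMk_productOut a, ← productMk_productOut b]
    congr 1
    funext t
    exact (Finite.equivFin (N t)).injective (Fin.ext (congrFun hab t))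
  simpa using Cardinal.lift_mk_le_lift_mk_of_injective h

theorem mem_coordSub {ι : Type*} {L : FirstOrder.Language.{u, v}} [L.IsRelational]
    {𝒟 : Ultrafilter ι} {N : ι → Type*} [∀ t, L.Structure (N t)]
    {S : L.Substructure ((𝒟 : Filter ι).Product N)} {t : ι} {y : N t} :
    y ∈ coordSub L 𝒟 N S t ↔ ∃ a ∈ S, productOut a t = y :=
  Substructure.mem_closure_iff_of_isRelational L _ _

/-- A partition relation for `C` passes to every structure containing a copy of `C`. -/
theorem exists_embedding_chromaticLE {L : FirstOrder.Language.{u, v}} {A B C N : Type*}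
    [L.Structure A] [L.Structure B] [L.Structure C] [L.Structure N] {k ℓ : ℕ} (e : C ↪[L] N)
    (h : ∀ c : Copy L A C → Fin k,
      ∃ B' : L.Substructure C, Nonempty (B ≃[L] B') ∧ ChromaticLE L c B' ℓ)
    (c : Copy L A N → Fin k) :
    ∃ g : B ↪[L] N, ChromaticLE L c g.toHom.range ℓ := by
  obtain ⟨B', ⟨i⟩, vals, hcard, hvals⟩ := h fun S =>
    c ⟨S.1.map e.toHom, ⟨(e.substructureEquivMap S.1).comp S.2.some⟩⟩
  refine ⟨e.comp (B'.subtype.comp i.toEmbedding), vals, hcard, fun S hS => ?_⟩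
  have hS' (y : N) (hy : y ∈ S.1) : ∃ x ∈ B', e x = y := by
    obtain ⟨b, hb⟩ := hS hy
    exact ⟨i b, (i b).2, hb⟩
  have hmap : (S.1.comap e.toHom).map e.toHom = S.1 := by
    refine le_antisymm (Substructure.map_le_iff_le_comap.2 le_rfl) fun y hy => ?_
    obtain ⟨x, -, rfl⟩ := hS' y hy
    exact ⟨x, hy, rfl⟩
  have hiso : Nonempty (A ≃[L] S.1.comap e.toHom) := by
    obtain ⟨j⟩ := S.2
    have f := e.substructureEquivMap (S.1.comap e.toHom)
    rw [hmap] at f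
    exact ⟨f.symm.comp j⟩
  have hmem := hvals ⟨S.1.comap e.toHom, hiso⟩ fun x hx => by
    obtain ⟨x', hx', h⟩ := hS' _ hx
    rwa [← e.injective h]
  have hval (T : Copy L A N) (hT : T.1 = S.1) (hc : c T ∈ vals) : c S ∈ vals := by
    rwa [← (Subtype.ext hT : T = S)]
  exact hval _ hmap hmem

/-- A witness for the small Ramsey property of a member of the class is positive. -/
theorem SmallRamseyWitness.pos {L : FirstOrder.Language.{u, v}}
    {𝒦 : Set (Bundled.{w} L.Structure)} {A : Bundled.{w} L.Structure} (hA : A ∈ 𝒦) {ℓ : ℕ}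
    (h : SmallRamseyWitness L 𝒦 A ℓ) : 0 < ℓ := by
  obtain ⟨C, -, hC⟩ := h 1 A hA
  obtain ⟨B', hB', vals, hcard, hvals⟩ := hC fun _ => 0
  exact (Finset.card_pos.2 ⟨_, hvals ⟨B', hB'⟩ le_rfl⟩).trans_le hcard

/-- Monochromaticity up to `ℓ` colors lifts from coordinates to the ultraproduct. -/
theorem chromaticLE_range_of_eventually {ι : Type*} {L : FirstOrder.Language.{u, v}}
    [L.IsRelational] {𝒟 : Ultrafilter ι} {N : ι → Type*} [∀ t, L.Structure (N t)]
    {A P : Type*} [L.Structure A] [L.Structure P] [Finite A] {k ℓ : ℕ}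
    {c : Copy L A ((𝒟 : Filter ι).Product N) → Fin k} {Z : Set ι}
    {ct : ∀ t : ι, Copy L A (N t) → Fin k}
    (hc : ∀ (A' : Copy L A ((𝒟 : Filter ι).Product N)) (j : Fin k),
      c A' = j ↔
        {t | t ∈ Z ∧ ∃ e : A ≃[L] (coordSub L 𝒟 N A'.1 t),
          ct t ⟨coordSub L 𝒟 N A'.1 t, ⟨e⟩⟩ = j} ∈ 𝒟)
    (F : P ↪[L] (𝒟 : Filter ι).Product N) (S : ∀ t, L.Substructure (N t))
    (hS : ∀ p, ∀ᶠ t in 𝒟, productOut (F p) t ∈ S t)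
    (h : ∀ᶠ t in 𝒟, ChromaticLE L (ct t) (S t) ℓ) :
    ChromaticLE L c F.toHom.range ℓ := by
  obtain ⟨vals, hvals⟩ : ∃ vals : Finset (Fin k), ∀ᶠ t in 𝒟, vals.card ≤ ℓ ∧
      ∀ B : Copy L A (N t), B.1 ≤ S t → ct t B ∈ vals :=
    Ultrafilter.eventually_exists_iff.1 h
  obtain ⟨t, ht⟩ := hvals.exists
  refine ⟨vals, ht.1, fun A' hA' => ?_⟩
  obtain ⟨i⟩ := A'.2
  have hfin : Finite A'.1 := Finite.of_equiv A i.toEquiv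
  have hsub : ∀ᶠ t in 𝒟, ∀ a : A'.1, productOut a.1 t ∈ S t := by
    refine eventually_all.2 fun a => ?_
    obtain ⟨p, hp⟩ := hA' a.2
    rw [← hp]
    exact hS p
  have hcol : ∀ᶠ t in 𝒟, t ∈ Z ∧ ∃ e : A ≃[L] (coordSub L 𝒟 N A'.1 t),
      ct t ⟨coordSub L 𝒟 N A'.1 t, ⟨e⟩⟩ = c A' := (hc A' _).1 rfl
  obtain ⟨t, ⟨-, ht⟩, hsub, -, e, he⟩ := (hvals.and (hsub.and hcol)).exists
  rw [← he]
  refine ht _ fun y hy => ?_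
  obtain ⟨a, ha, rfl⟩ := mem_coordSub.1 hy
  exact hsub ⟨a, ha⟩

/-- Under the Continuum Hypothesis, an ultraproduct along a trending sequence embeds into every
ultraproduct of members of the sequence into which all members eventually embed. -/
theorem nonempty_embedding_product_of_trending {L : FirstOrder.Language.{u, v}}
    [L.IsRelational] [Finite (Σ n, L.Relations n)] (CH : Cardinal.continuum.{w} = Cardinal.aleph 1)
    {𝒟 : Ultrafilter ℕ} (hD : (𝒟 : Filter ℕ) ≤ atTop)
    {M N : ℕ → Type w} [∀ t, L.Structure (M t)] [∀ t, Finite (M t)] [∀ t, L.Structure (N t)]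
    [∀ t, Nonempty (N t)] (h : ∀ s, ∀ᶠ t in 𝒟, Nonempty (M s ↪[L] N t)) :
    Nonempty ((𝒟 : Filter ℕ).Product M ↪[L] (𝒟 : Filter ℕ).Product N) := by
  classical
  refine nonempty_embedding_of_finite_parts hD
    ((mk_product_le_continuum _ _).trans CH.le) fun F => ?_
  let S : L.Substructure ((𝒟 : Filter ℕ).Product M) :=
    Substructure.closure L (F : Set ((𝒟 : Filter ℕ).Product M))
  have hS : (S : Set ((𝒟 : Filter ℕ).Product M)) = F := Substructure.closure_eq_of_isRelational L _
  have hmem (p) : p ∈ S ↔ p ∈ F := by rw [← SetLike.mem_coe, hS, Finset.mem_coe]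
  have : Finite S := (F.finite_toSet.subset hS.le).to_subtype
  obtain ⟨s, ⟨f⟩⟩ := (eventually_nonempty_embedding S.subtype).exists
  obtain ⟨g⟩ := nonempty_embedding_product_of_eventually (h s)
  refine ⟨fun p => if hp : p ∈ S then g (f ⟨p, hp⟩) else Classical.arbitrary _, ?_, ?_⟩
  · intro a ha b hb hab
    have ha' := (hmem a).2 ha
    have hb' := (hmem b).2 hb
    simp only [ha', hb', dite_true] at hab
    exact congrArg Subtype.val (f.injective (g.injective hab))
  · intro n r x hx
    have hx' (i) : x i ∈ S := (hmem _).2 (hx i)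
    have : (fun p => if hp : p ∈ S then g (f ⟨p, hp⟩) else Classical.arbitrary _) ∘ x =
        (g.comp f) ∘ fun i => (⟨x i, hx' i⟩ : S) := by
      funext i
      simp [hx' i]
    rw [this, (g.comp f).map_rel, ← S.subtype.map_rel]
    rfl

/-- If all factors are nonempty, a small Ramsey witness for a member of the age of an ultraproduct
along a trending sequence is an internal big Ramsey witness. -/
theorem internalBigRamseyWitness_of_nonempty {L : FirstOrder.Language.{u, v}}
    [L.IsRelational] [Finite (Σ n, L.Relations n)] (CH : Cardinal.continuum.{w} = Cardinal.aleph 1)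
    {𝒟 : Ultrafilter ℕ} (hD : (𝒟 : Filter ℕ) ≤ atTop)
    {M : ℕ → Type w} [∀ t, L.Structure (M t)] [∀ t, Finite (M t)] [∀ t, Nonempty (M t)]
    (htrend : ∀ i : ℕ, ∀ᶠ t in 𝒟, Nonempty (M i ↪[L] M t))
    {A : Bundled.{w} L.Structure} (hA : A ∈ L.age ((𝒟 : Filter ℕ).Product M)) {d : ℕ}
    (hd : SmallRamseyWitness L (L.age ((𝒟 : Filter ℕ).Product M)) A d) :
    InternalBigRamseyWitness L 𝒟 M A d := by
  classical
  rintro k c ⟨Z, -, ct, hc⟩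
  have : Finite A := hA.1.finite
  have hgood (i : ℕ) : ∀ᶠ t in 𝒟, ∃ g : M i ↪[L] M t, ChromaticLE L (ct t) g.toHom.range d := by
    obtain ⟨C, ⟨hCfg, ⟨f⟩⟩, hC⟩ := hd k (Bundled.of (M i))
      ⟨Structure.fg_iff_finite.2 (inferInstanceAs (Finite (M i))),
        nonempty_embedding_product_of_eventually (htrend i)⟩
    have : Finite C := hCfg.finite
    filter_upwards [eventually_nonempty_embedding f] with t ⟨e⟩
    exact exists_embedding_chromaticLE e hC (ct t)
  have hh (m : ℕ) : ∃ s, ∀ i ≤ m, Nonempty (M i ↪[L] M s) :=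
    ((eventually_all_finite (Set.finite_Iic m)).2 fun i _ => htrend i).exists
  choose h hh using hh
  obtain ⟨n, hn, hE⟩ := exists_tendsto_atTop_of_eventually hD
    (fun m t => ∃ g : M (h m) ↪[L] M t, ChromaticLE L (ct t) g.toHom.range d)
    fun m => hgood (h m)
  obtain ⟨F⟩ := nonempty_embedding_product_of_trending (N := fun t => M (h (n t))) CH hD
    (fun s => by
      filter_upwards [hn.eventually_ge_atTop s] with t ht
      exact hh (n t) s ht)
  have hex (t : ℕ) : ∃ (g : M (h (n t)) → M t) (S : L.Substructure (M t)),
      (∃ g' : M (h (n t)) ↪[L] M t, ChromaticLE L (ct t) g'.toHom.range d) →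
      ∃ g' : M (h (n t)) ↪[L] M t, ⇑g' = g ∧ g'.toHom.range = S ∧ ChromaticLE L (ct t) S d := by
    by_cases ht : ∃ g' : M (h (n t)) ↪[L] M t, ChromaticLE L (ct t) g'.toHom.range d
    · obtain ⟨g', hg'⟩ := ht
      exact ⟨g', g'.toHom.range, fun _ => ⟨g', rfl, rfl, hg'⟩⟩
    · exact ⟨fun _ => Classical.arbitrary _, ⊤, fun h => (ht h).elim⟩
  choose g S hgS using hex
  have hgS' := hE.mono hgS
  obtain ⟨G, hG⟩ := exists_embedding_product (L := L) (𝒟 := 𝒟)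
    (fun (a : (𝒟 : Filter ℕ).Product fun t => M (h (n t))) t => g t (productOut a t))
    (by
      intro x y hxy
      rw [← productMk_productOut x, ← productMk_productOut y, productMk_eq_iff]
      filter_upwards [hgS', hxy] with t ⟨g', hg', _⟩ ht
      exact g'.injective (by rw [hg']; exact ht))
    (by
      intro m r x
      rw [relMap_iff_productOut]
      refine eventually_congr ?_
      filter_upwards [hgS'] with t ⟨g', hg', _⟩
      rw [← hg']
      exact g'.map_rel r fun i => productOut (x i) t)
  refine ⟨(G.comp F).toHom.range, ⟨(G.comp F).equivRange⟩,
    chromaticLE_range_of_eventually hc (G.comp F) S (fun p => ?_)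
      (hgS'.mono fun t ⟨_, _, _, ht⟩ => ht)⟩
  rw [Embedding.comp_apply, hG]
  filter_upwards [hgS', productOut_productMk (l := (𝒟 : Filter ℕ))
    fun t => g t (productOut (F p) t)] with t ⟨g', hg', hS', _⟩ ht
  rw [ht, ← hS', ← hg']
  exact ⟨_, rfl⟩

/-- Over an empty structure every positive number is an internal big Ramsey witness. -/
theorem internalBigRamseyWitness_of_isEmpty {L : FirstOrder.Language.{u, v}}
    {𝒟 : Ultrafilter ℕ} {M : ℕ → Type w} [∀ t, L.Structure (M t)]
    [IsEmpty ((𝒟 : Filter ℕ).Product M)] {A : Type*} [L.Structure A] {d : ℕ} (hd : 0 < d) :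
    InternalBigRamseyWitness L 𝒟 M A d := by
  classical
  intro k c _
  have hsub (S T : Copy L A ((𝒟 : Filter ℕ).Product M)) : S = T :=
    Subtype.ext (SetLike.ext fun x => isEmptyElim x)
  refine ⟨_, ⟨(Embedding.refl L _).equivRange⟩, ?_⟩
  by_cases h : Nonempty (Copy L A ((𝒟 : Filter ℕ).Product M))
  · exact ⟨{c h.some}, by simpa using Nat.succ_le_of_lt hd, fun S _ => by simp [hsub S h.some]⟩
  · exact ⟨∅, by simp, fun S => (h ⟨S⟩).elim⟩

/-- Corollary under CH: for a finite relational signature, a nonprincipal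
ultrafilter `𝒟` on `ω` and a `𝒟`-trending sequence of finite structures with ultraproduct
`M*`, if `𝒜 ∈ age M*` has finite small Ramsey degree `d` in `age M*`, then, assuming the
Continuum Hypothesis, `𝒜` has finite internal big Ramsey degree `T` in `M*` and `T ≤ d`. -/
theorem internal_big_ramsey_of_small_ramsey_CH
    (CH : Cardinal.continuum.{w} = Cardinal.aleph 1)
    [L.IsRelational] [Finite (Σ n, L.Relations n)]
    (𝒟 : Ultrafilter ℕ) (h𝒟 : ∀ a : ℕ, 𝒟 ≠ pure a)
    (M : ℕ → Type w) [∀ t, L.Structure (M t)] [∀ t, Finite (M t)]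
    (htrend : DTrending L 𝒟 M)
    (A : Bundled.{w} L.Structure) (hA : A ∈ L.age ((𝒟 : Filter ℕ).Product M))
    (d : ℕ)
    (hd : IsLeast {ℓ : ℕ | SmallRamseyWitness L (L.age ((𝒟 : Filter ℕ).Product M)) A ℓ} d) :
    ∃ T : ℕ, IsLeast {ℓ : ℕ | InternalBigRamseyWitness L 𝒟 M A ℓ} T ∧ T ≤ d := by
  have hD : (𝒟 : Filter ℕ) ≤ atTop := by
    rw [← Nat.cofinite_eq_atTop]
    rcases 𝒟.le_cofinite_or_eq_pure with h | ⟨a, h⟩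
    · exact h
    · exact (h𝒟 a h).elim
  have hwit : InternalBigRamseyWitness L 𝒟 M A d := by
    by_cases hM : ∀ t, Nonempty (M t)
    · exact internalBigRamseyWitness_of_nonempty CH hD htrend.2.2 hA hd.1
    · have : IsEmpty ((𝒟 : Filter ℕ).Product M) :=
        ⟨fun a => hM fun t => ⟨productOut a t⟩⟩
      exact internalBigRamseyWitness_of_isEmpty (SmallRamseyWitness.pos hA hd.1)
  classical
  exact ⟨Nat.find ⟨d, hwit⟩, ⟨Nat.find_spec ⟨d, hwit⟩, fun ℓ hℓ => Nat.find_min' ⟨d, hwit⟩ hℓ⟩,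
    Nat.find_min' ⟨d, hwit⟩ hwit⟩

end BRD
end

section
/- Let ℒ be a signature, N an infinite, locally finite ℒ-structure, and 𝒜 a finite ℒ-structure. If 𝒜 has finite big Ramsey degree in N, then 𝒜 has finite small Ramsey degree in age(N), and d(𝒜, age(N)) ≤ T(𝒜, N). -/
open FirstOrder Language CategoryTheory Filter

universe u v w x

namespace BRD

variable (L : FirstOrder.Language.{u, v})

/-- `ℓ` witnesses the big Ramsey property for `A` in the infinite structure `N`: every finite
coloring of the copies of `A` in `N` takes at most `ℓ` values on the copies of `A` contained
in some copy of `N` within `N`. -/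
def BigRamseyWitness (A : Type*) [L.Structure A] (N : Type*) [L.Structure N] (ℓ : ℕ) :
    Prop :=
  ∀ k : ℕ, ∀ c : Copy L A N → Fin k,
    ∃ N' : L.Substructure N, Nonempty (N ≃[L] N') ∧ ChromaticLE L c N' ℓ

variable {L}

/-- A copy of `X` in `N` lying below `S` is also a copy of `X` in `S`. -/
theorem exists_copy_of_le {X : Type*} [L.Structure X] {N : Type*} [L.Structure N]
    {P S : L.Substructure N} (e : Nonempty (X ≃[L] P)) (h : P ≤ S) :
    ∃ Q : Copy L X S, Q.1.map S.subtype.toHom = P := by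
  obtain ⟨e⟩ := e
  refine ⟨⟨(Substructure.inclusion h).toHom.range,
    ⟨(Substructure.inclusion h).equivRange.comp e⟩⟩, ?_⟩
  rw [← Hom.range_comp]
  exact Substructure.range_subtype P

theorem mono_chromaticLE {A : Type*} [L.Structure A] {N : Type*} [L.Structure N] {k ℓ : ℕ}
    {c : Copy L A N → Fin k} {P Q : L.Substructure N} (h : P ≤ Q) (hc : ChromaticLE L c Q ℓ) :
    ChromaticLE L c P ℓ := by
  obtain ⟨vals, hcard, hvals⟩ := hc
  exact ⟨vals, hcard, fun S hS => hvals S (hS.trans h)⟩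

theorem finite_copies_le {A : Type*} [L.Structure A] {N : Type*} [L.Structure N]
    (P : L.Substructure N) [Finite P] : {S : Copy L A N | S.1 ≤ P}.Finite := by
  refine Set.Finite.of_finite_image (f := fun S : Copy L A N => (S.1 : Set N))
    (Set.Finite.subset (Set.Finite.finite_subsets (Set.toFinite (P : Set N))) ?_) ?_
  · rintro _ ⟨S, hS, rfl⟩
    exact hS
  · intro S _ S' _ h
    exact Subtype.ext (SetLike.coe_injective h)

/-- An ultralimit of colorings: given colorings of the copies of `A` in every finitely generated
substructure of `N`, there is a coloring `c` of the copies of `A` in `N` such that for every finite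
`P` some finitely generated `S ≥ P` has a coloring agreeing with `c` below `P`. -/
theorem exists_limit_coloring {A : Type*} [L.Structure A] [Finite A]
    {N : Type*} [L.Structure N] {k : ℕ}
    (cS : ∀ S : {S : L.Substructure N // S.FG}, Copy L A S.1 → Fin k) :
    ∃ c : Copy L A N → Fin k, ∀ P : L.Substructure N, Finite P →
      ∃ S : {S : L.Substructure N // S.FG}, P ≤ S.1 ∧
        ∀ (R : Copy L A N) (Q : Copy L A S.1), R.1 ≤ P →
          Q.1.map S.1.subtype.toHom = R.1 → cS S Q = c R := by
  have : Nonempty {S : L.Substructure N // S.FG} := ⟨⟨⊥, Substructure.fg_bot⟩⟩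
  have : IsDirectedOrder {S : L.Substructure N // S.FG} :=
    ⟨fun S S' => ⟨⟨S.1 ⊔ S'.1, S.2.sup S'.2⟩, le_sup_left (a := S.1), le_sup_right (a := S.1)⟩⟩
  obtain ⟨U, hU⟩ := Ultrafilter.exists_le (atTop : Filter {S : L.Substructure N // S.FG})
  have above : ∀ P : L.Substructure N, Finite P →
      ∀ᶠ S in (U : Filter {S : L.Substructure N // S.FG}), P ≤ S.1 :=
    fun P _ => hU (eventually_ge_atTop
      (⟨P, Substructure.FG.of_finite⟩ : {S : L.Substructure N // S.FG}))
  have limit : ∀ R : Copy L A N, ∃ i : Fin k, ∀ᶠ S in (U : Filter {S : L.Substructure N // S.FG}),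
      ∃ Q : Copy L A S.1, Q.1.map S.1.subtype.toHom = R.1 ∧ cS S Q = i := by
    intro R
    have hR : Finite R.1 := Finite.of_equiv A R.2.some.toEquiv
    have ev : ∀ᶠ S in (U : Filter {S : L.Substructure N // S.FG}), ∃ i ∈ (Set.univ : Set (Fin k)),
        ∃ Q : Copy L A S.1, Q.1.map S.1.subtype.toHom = R.1 ∧ cS S Q = i := by
      filter_upwards [above R.1 hR] with S hS
      obtain ⟨Q, hQ⟩ := exists_copy_of_le R.2 hS
      exact ⟨_, trivial, Q, hQ, rfl⟩
    obtain ⟨i, -, hi⟩ := (Ultrafilter.eventually_exists_mem_iff Set.finite_univ).1 ev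
    exact ⟨i, hi⟩
  choose c hc using limit
  refine ⟨c, fun P hP => ?_⟩
  have agree := (Filter.eventually_all_finite (finite_copies_le (A := A) P)).2 fun R _ => hc R
  obtain ⟨S, hS, hagree⟩ := ((above P hP).and agree).exists
  refine ⟨S, hS, fun R Q hR hQ => ?_⟩
  obtain ⟨Q', hQ', hcol⟩ := hagree R hR
  rw [← hcol]
  congr 1
  exact Subtype.ext (Substructure.map_injective_of_injective S.1.subtype_injective
    (hQ.trans hQ'.symm))

theorem BigRamseyWitness.smallRamseyWitness {N : Type w} [L.Structure N]
    (hlocfin : ∀ S : L.Substructure N, S.FG → Finite S)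
    {A : Bundled.{w} L.Structure} [Finite A] {ℓ : ℕ} (h : BigRamseyWitness L A N ℓ) :
    SmallRamseyWitness L (L.age N) A ℓ := by
  intro k B hB
  by_contra! hbad
  choose cS hcS using fun S : {S : L.Substructure N // S.FG} =>
    hbad (Bundled.mk S.1) (age.fg_substructure S.2)
  obtain ⟨c, hc⟩ := exists_limit_coloring cS
  obtain ⟨N', ⟨e⟩, hN'⟩ := h k c
  obtain ⟨hBfg, ⟨f⟩⟩ := hB
  let g : B ↪[L] N := N'.subtype.comp (e.toEmbedding.comp f)
  have hgN' : g.toHom.range ≤ N' := by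
    rintro _ ⟨x, rfl⟩
    exact (e (f x)).2
  obtain ⟨S, hS, hagree⟩ := hc g.toHom.range (hlocfin _ (hBfg.range g.toHom))
  obtain ⟨B', hB'⟩ := exists_copy_of_le ⟨g.equivRange⟩ hS
  obtain ⟨vals, hcard, hvals⟩ := mono_chromaticLE hgN' hN'
  refine hcS S B'.1 B'.2 ⟨vals, hcard, fun Q hQ => ?_⟩
  let R : Copy L A N := ⟨Q.1.map S.1.subtype.toHom,
    Q.2.map fun e => (S.1.subtype.substructureEquivMap Q.1).comp e⟩
  have hR : R.1 ≤ g.toHom.range := hB' ▸ Substructure.monotone_map hQ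
  rw [hagree R Q hR rfl]
  exact hvals R hR

variable (L)

/-- Observation `big-implies-small`: if `N` is an infinite locally finite
structure and the finite structure `𝒜` has finite big Ramsey degree `T` in `N`, then `𝒜` has
finite small Ramsey degree `d` in `age N` with `d ≤ T`. -/
theorem small_ramsey_of_big_ramsey
    (N : Type w) [L.Structure N] (hNinf : Infinite N)
    (hlocfin : ∀ S : L.Substructure N, S.FG → Finite S)
    (A : Bundled.{w} L.Structure) (hAfin : Finite A)
    (T : ℕ) (hT : IsLeast {ℓ : ℕ | BigRamseyWitness L A N ℓ} T) :
    ∃ d : ℕ, IsLeast {ℓ : ℕ | SmallRamseyWitness L (L.age N) A ℓ} d ∧ d ≤ T := by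
  have hsmall : T ∈ {ℓ : ℕ | SmallRamseyWitness L (L.age N) A ℓ} :=
    BigRamseyWitness.smallRamseyWitness hlocfin hT.1
  exact ⟨_, ⟨Nat.sInf_mem ⟨T, hsmall⟩, fun _ h => Nat.sInf_le h⟩, Nat.sInf_le hsmall⟩

end BRD
end

section
/- Let ℒ be a countable signature and 𝒟 a nonprincipal ultrafilter over ω. Then for any family (𝔄_i)_{i∈ω} of ℒ-structures, the ultraproduct ∏_{i∈ω} 𝔄_i/𝒟 is ℵ₁-saturated. -/
open FirstOrder Language Filter

universe u v w

namespace BRD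

variable (L : FirstOrder.Language.{u, v})

/-- The assignment `v` of elements of `M` to the variables `β` realizes the type `p`, a set of
formulas with free variables among `β` and parameters from `A ⊆ M`. -/
def RealizesType (M : Type w) [L.Structure M] {β : Type w} {A : Set M}
    (v : β → M) (p : Set (L.Formula (β ⊕ ↥A))) : Prop :=
  ∀ φ ∈ p, Formula.Realize φ (Sum.elim v (fun a => (a : M)))

/-- The set `p` of formulas with free variables among `β` and parameters from `A ⊆ M` is
finitely satisfiable in `M`. -/
def FinitelySatisfiable (M : Type w) [L.Structure M] {β : Type w} {A : Set M}
    (p : Set (L.Formula (β ⊕ ↥A))) : Prop :=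
  ∀ s : Finset (L.Formula (β ⊕ ↥A)), ↑s ⊆ p →
    ∃ v : β → M, ∀ φ ∈ s, Formula.Realize φ (Sum.elim v (fun a => (a : M)))

/-- `M` is `κ`-saturated (for 1-types): every finitely satisfiable set of formulas in one
free variable with parameters from a subset of `M` of cardinality `< κ` is realized in
`M`. -/
def IsSaturated (κ : Cardinal.{w}) (M : Type w) [L.Structure M] : Prop :=
  ∀ A : Set M, Cardinal.mk A < κ →
    ∀ p : Set (L.Formula (PUnit ⊕ ↥A)), FinitelySatisfiable L M p →
      ∃ v : PUnit → M, RealizesType L M v p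

/-- Diagonal choice along a filter on `ℕ` refining the cofinite filter: countably many conditions,
every finite number of which are eventually simultaneously satisfiable, are each eventually
satisfied by a single choice function. -/
theorem exists_forall_eventually_of_forall_lt {f : Filter ℕ} (hf : f ≤ cofinite)
    {X : ℕ → Type*} [∀ i, Nonempty (X i)] (P : ∀ i, ℕ → X i → Prop)
    (h : ∀ n, ∀ᶠ i in f, ∃ m, ∀ k < n, P i k m) :
    ∃ m : ∀ i, X i, ∀ k, ∀ᶠ i in f, P i k (m i) := by
  classical
  let N : ℕ → ℕ := fun i => Nat.findGreatest (fun n => ∃ m, ∀ k < n, P i k m) i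
  have hN : ∀ i, ∃ m, ∀ k < N i, P i k m := fun i =>
    Nat.findGreatest_spec (P := fun n => ∃ m, ∀ k < n, P i k m) (Nat.zero_le i)
      ⟨Classical.arbitrary _, fun k hk => absurd hk k.not_lt_zero⟩
  choose m hm using hN
  refine ⟨m, fun k => ?_⟩
  have hk : ∀ᶠ i in f, k + 1 ≤ i := by
    rw [Nat.cofinite_eq_atTop] at hf
    exact hf (eventually_ge_atTop (k + 1))
  filter_upwards [h (k + 1), hk] with i hi hki
  exact hm i k (Nat.le_findGreatest hki hi)

/-- Over a countable language, there are countably many formulas in countably many variables. -/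
theorem countable_formula {L : FirstOrder.Language.{u, v}} (hL : L.card ≤ Cardinal.aleph0)
    (β : Type w) [Countable β] : Countable (L.Formula β) := by
  have h : Countable (Σ n, L.BoundedFormula β n) := by
    rw [← Cardinal.mk_le_aleph0_iff]
    refine BoundedFormula.card_le.trans (max_le le_rfl (Cardinal.add_le_aleph0.2 ⟨?_, ?_⟩))
    · simp
    · simpa using hL
  exact Function.Injective.countable (f := fun φ : L.Formula β =>
    (⟨0, φ⟩ : Σ n, L.BoundedFormula β n))
    fun _ _ hφ => eq_of_heq (Sigma.mk.inj hφ).2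

/-- Corollary `minimal_saturation`: for a countable signature and a
nonprincipal ultrafilter `𝒟` over `ω`, any ultraproduct `∏ᵢ 𝔄ᵢ/𝒟` is `ℵ₁`-saturated. -/
theorem ultraproduct_aleph_one_saturated
    (hL : L.card ≤ Cardinal.aleph0)
    (𝒟 : Ultrafilter ℕ) (h𝒟 : ∀ a : ℕ, 𝒟 ≠ pure a)
    (A : ℕ → Type w) [∀ i, L.Structure (A i)] :
    IsSaturated L (Cardinal.aleph 1) ((𝒟 : Filter ℕ).Product A) := by
  intro B hB p hp
  obtain ⟨v₀, -⟩ := hp ∅ (by simp)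
  obtain ⟨a₀, -⟩ := Quotient.exists_rep (v₀ PUnit.unit)
  have : ∀ i, Nonempty (A i) := fun i => ⟨a₀ i⟩
  have : Countable B := by
    rwa [← Cardinal.mk_le_aleph0_iff, ← Order.lt_succ_iff, Cardinal.succ_aleph0]
  have := countable_formula hL (PUnit.{w + 1} ⊕ B)
  obtain rfl | hne := p.eq_empty_or_nonempty
  · exact ⟨v₀, fun φ hφ => hφ.elim⟩
  obtain ⟨φ, rfl⟩ := p.to_countable.exists_eq_range hne
  have hlift : ∀ b : B, ∃ x : ∀ i, A i, (x : (𝒟 : Filter ℕ).Product A) = b.1 :=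
    fun b => Quotient.exists_rep b.1
  choose x hx using hlift
  have realize_iff : ∀ (ψ : L.Formula (PUnit.{w + 1} ⊕ B)) (m : ∀ i, A i),
      ψ.Realize (Sum.elim (fun _ => (m : (𝒟 : Filter ℕ).Product A)) fun b : B => b.1) ↔
        ∀ᶠ i in 𝒟, ψ.Realize (Sum.elim (fun _ => m i) fun b => x b i) := by
    intro ψ m
    have hv : (Sum.elim (fun _ => (m : (𝒟 : Filter ℕ).Product A)) fun b : B => b.1) =
        fun c : PUnit.{w + 1} ⊕ B =>
          ((Sum.elim (fun _ => m) x c : ∀ i, A i) : (𝒟 : Filter ℕ).Product A) := by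
      funext c
      cases c with
      | inl => rfl
      | inr b => exact (hx b).symm
    have hv' : ∀ i, (Sum.elim (fun _ => m i) fun b => x b i) =
        fun c : PUnit.{w + 1} ⊕ B => Sum.elim (fun _ => m) x c i := by
      intro i
      funext c
      cases c <;> rfl
    simp only [hv, hv']
    exact Ultraproduct.realize_formula_cast ψ _
  obtain ⟨m, hm⟩ := exists_forall_eventually_of_forall_lt
    (𝒟.le_cofinite_or_eq_pure.resolve_right fun ⟨a, ha⟩ => h𝒟 a ha)
    (fun i k (m : A i) => (φ k).Realize (Sum.elim (fun _ => m) fun b => x b i)) (fun n => by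
      classical
      obtain ⟨v, hv⟩ := hp ((Finset.range n).image φ) (by simp)
      obtain ⟨m, hm⟩ := Quotient.exists_rep (v PUnit.unit)
      obtain rfl : v = fun _ => (m : (𝒟 : Filter ℕ).Product A) := funext fun _ => hm.symm
      have hev : ∀ᶠ i in 𝒟, ∀ k ∈ Finset.range n,
          (φ k).Realize (Sum.elim (fun _ => m i) fun b => x b i) :=
        (Finset.eventually_all _).2 fun k hk =>
          (realize_iff _ m).1 (hv _ (Finset.mem_image_of_mem φ hk))
      exact hev.mono fun i hi => ⟨m i, fun k hk => hi k (Finset.mem_range.2 hk)⟩)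
  refine ⟨fun _ => (m : (𝒟 : Filter ℕ).Product A), ?_⟩
  rintro _ ⟨k, rfl⟩
  exact (realize_iff _ m).2 (hm k)

end BRD
end

section
/- Let L be any linear order and equip L × ℤ with the lexicographic order. Then for every order-embedding e : ℚ → L × ℤ, the composition of e with the projection L × ℤ → L is injective; consequently, any suborder of L × ℤ order-isomorphic to (ℚ, <) meets each fiber {l} × ℤ in at most one point and projects to a suborder of L order-isomorphic to (ℚ, <). -/
namespace BRD

/-- A strictly monotone map from a densely ordered type to a lexicographic product with locally
finite second factor stays strictly monotone after projecting to the first factor. -/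
theorem strictMono_fst_ofLex_of_denselyOrdered {α L β : Type*} [LinearOrder α] [DenselyOrdered α]
    [LinearOrder L] [LinearOrder β] [LocallyFiniteOrder β] {f : α → L ×ₗ β} (hf : StrictMono f) :
    StrictMono fun a => (ofLex (f a)).1 := by
  have hmono : Monotone fun a => (ofLex (f a)).1 := fun _ _ h =>
    Prod.Lex.monotone_fst _ _ (hf.monotone h)
  intro a b hab
  refine (hmono hab.le).lt_of_ne fun heq => ?_
  have hconst : ∀ c ∈ Set.Icc a b, (ofLex (f c)).1 = (ofLex (f a)).1 := fun c hc =>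
    le_antisymm ((hmono hc.2).trans_eq heq.symm) (hmono hc.1)
  have hsnd : StrictMonoOn (fun c => (ofLex (f c)).2) (Set.Icc a b) := by
    intro c hc d hd hcd
    rcases Prod.Lex.lt_iff.1 (hf hcd) with h | h
    · exact absurd ((hconst c hc).trans (hconst d hd).symm) h.ne
    · exact h.2
  have hmaps : Set.MapsTo (fun c => (ofLex (f c)).2) (Set.Icc a b)
      (Set.Icc (ofLex (f a)).2 (ofLex (f b)).2) := fun c hc =>
    ⟨hsnd.monotoneOn (Set.left_mem_Icc.2 hab.le) hc hc.1,
      hsnd.monotoneOn hc (Set.right_mem_Icc.2 hab.le) hc.2⟩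
  exact Set.Icc_infinite hab (Set.Finite.of_injOn hmaps hsnd.injOn (Set.finite_Icc _ _))

/-- for any linear order `L`, every order-embedding of `ℚ` into the
lexicographic product `L ×ₗ ℤ` composes injectively with the projection to `L`;
consequently, any suborder of `L ×ₗ ℤ` order-isomorphic to `(ℚ, <)` meets each fiber
`{l} × ℤ` in at most one point and projects to a suborder of `L` order-isomorphic to
`(ℚ, <)`. -/
theorem rational_suborder_of_lex_int_projects
    (L : Type*) [LinearOrder L] :
    (∀ e : ℚ ↪o (L ×ₗ ℤ), Function.Injective fun q : ℚ => (ofLex (e q)).1) ∧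
    ∀ Y : Set (L ×ₗ ℤ), Nonempty (Y ≃o ℚ) →
      (∀ y₁ ∈ Y, ∀ y₂ ∈ Y, (ofLex y₁).1 = (ofLex y₂).1 → y₁ = y₂) ∧
      Nonempty (((fun p : L ×ₗ ℤ => (ofLex p).1) '' Y) ≃o ℚ) := by
  refine ⟨fun e => (strictMono_fst_ofLex_of_denselyOrdered e.strictMono).injective, ?_⟩
  rintro Y ⟨φ⟩
  have : DenselyOrdered Y := (denselyOrdered_iff_of_orderIsoClass φ).2 inferInstance
  have hproj : StrictMono fun y : Y => (ofLex (y : L ×ₗ ℤ)).1 :=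
    strictMono_fst_ofLex_of_denselyOrdered (Subtype.strictMono_coe Y)
  refine ⟨fun y₁ h₁ y₂ h₂ h => 
    congrArg Subtype.val (hproj.injective (a₁ := ⟨y₁, h₁⟩) (a₂ := ⟨y₂, h₂⟩) h), ?_⟩
  rw [Set.image_eq_range]
  exact ⟨(hproj.orderIso _).symm.trans φ⟩

end BRD
end
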